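/- Let α : U → ℝ be a smooth fixed-mode solution of the spin-s Teukolsky equation. Then for every integer N ≥ 1 the following identity holds pointwise on U: ∂ᵤ( (D/r²)^(N+s) · ∂ᵥ( ((r²/D)∂ᵥ)^N α ) ) = (D/r²)^(N+s+1) · [ ( N(N+1+2s) + Λ − ( (1+s)(1+2s) + 3N(N+1+2s) )·(2M/r) ) · ((r²/D)∂ᵥ)^N α + 2M · N(N+s)(N+2s) · ((r²/D)∂ᵥ)^(N−1) α ]. (For N = 0 the identity reduces to the Teukolsky equation itself; this is the ∂ᵥ-commuted Teukolsky equation of Proposition 8.1, eq. (8.7), in scalar fixed-angular-mode form, with coefficients a^s_{N,0} = N(N+1+2s), b^s_{N,0} = 1, c^s_{N,0} = (1+s)(1+2s)+3N(N+1+2s), a^s_{N,1} = N(N+s)(N+2s).) -/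

import Mathlib

open scoped ContDiff

noncomputable section

/-- Partial derivative with respect to the first (`u`) null coordinate. -/
def pdu (f : ℝ × ℝ → ℝ) : ℝ × ℝ → ℝ := fun p => deriv (fun x => f (x, p.2)) p.1

/-- Partial derivative with respect to the second (`v`) null coordinate. -/
def pdv (f : ℝ × ℝ → ℝ) : ℝ × ℝ → ℝ := fun p => deriv (fun y => f (p.1, y)) p.2

/-- `D = 1 - 2M/r`. -/
def Dfun (M : ℝ) (r : ℝ × ℝ → ℝ) : ℝ × ℝ → ℝ := fun p => 1 - 2 * M / r p

/-- The weighted transversal derivative operator `(r²/D)∂ᵥ`. -/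
def Pv (M : ℝ) (r f : ℝ × ℝ → ℝ) : ℝ × ℝ → ℝ := fun p => (r p) ^ 2 / Dfun M r p * pdv f p

/-- `α` is a fixed-mode solution of the spin-`s` Teukolsky equation (Teuk:s) on `U`,
projected to spherical-harmonic number `ℓ`, i.e.
`∂ᵤ(r^(−2s) D^s ∂ᵥα) = D^(s+1) r^(−2−2s) Λ α − 2M D^(s+1) r^(−3−2s) (1+s)(1+2s) α`
with `Λ = −(ℓ−s)(ℓ+s+1)`. -/
def TeukSol (M : ℝ) (r : ℝ × ℝ → ℝ) (U : Set (ℝ × ℝ)) (s ℓ : ℤ) (α : ℝ × ℝ → ℝ) : Prop :=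
  ∀ p ∈ U,
    pdu (fun q => (r q) ^ (-(2 * s)) * (Dfun M r q) ^ s * pdv α q) p =
      (Dfun M r p) ^ (s + 1) * (r p) ^ (-2 - 2 * s) * ((-(ℓ - s) * (ℓ + s + 1) : ℤ) : ℝ) * α p
        - 2 * M * (Dfun M r p) ^ (s + 1) * (r p) ^ (-3 - 2 * s) *
          (((1 + s) * (1 + 2 * s) : ℤ) : ℝ) * α p

section PartialDerivatives

variable {U : Set (ℝ × ℝ)} {f g : ℝ × ℝ → ℝ} {p : ℝ × ℝ}

theorem DifferentiableAt.hasDerivAt_fst (hf : DifferentiableAt ℝ f p) :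
    HasDerivAt (fun x => f (x, p.2)) (fderiv ℝ f p (1, 0)) p.1 :=
  hf.hasFDerivAt.comp_hasDerivAt p.1 ((hasDerivAt_id p.1).prodMk (hasDerivAt_const p.1 p.2))

theorem DifferentiableAt.hasDerivAt_snd (hf : DifferentiableAt ℝ f p) :
    HasDerivAt (fun y => f (p.1, y)) (fderiv ℝ f p (0, 1)) p.2 :=
  hf.hasFDerivAt.comp_hasDerivAt p.2 ((hasDerivAt_const p.2 p.1).prodMk (hasDerivAt_id p.2))

theorem DifferentiableAt.pdu_eq (hf : DifferentiableAt ℝ f p) :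
    pdu f p = fderiv ℝ f p (1, 0) :=
  hf.hasDerivAt_fst.deriv

theorem DifferentiableAt.pdv_eq (hf : DifferentiableAt ℝ f p) :
    pdv f p = fderiv ℝ f p (0, 1) :=
  hf.hasDerivAt_snd.deriv

theorem DifferentiableAt.hasDerivAt_pdu (hf : DifferentiableAt ℝ f p) :
    HasDerivAt (fun x => f (x, p.2)) (pdu f p) p.1 :=
  hf.pdu_eq ▸ hf.hasDerivAt_fst

theorem DifferentiableAt.hasDerivAt_pdv (hf : DifferentiableAt ℝ f p) :
    HasDerivAt (fun y => f (p.1, y)) (pdv f p) p.2 :=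
  hf.pdv_eq ▸ hf.hasDerivAt_snd

theorem ContDiffOn.differentiableAt_of_isOpen (hf : ContDiffOn ℝ ∞ f U) (hU : IsOpen U)
    (hp : p ∈ U) : DifferentiableAt ℝ f p :=
  (hf.contDiffAt (hU.mem_nhds hp)).differentiableAt (by simp)

theorem pdu_congr (hU : IsOpen U) (hfg : Set.EqOn f g U) (hp : p ∈ U) : pdu f p = pdu g p := by
  refine Filter.EventuallyEq.deriv_eq ?_
  have hc : ContinuousAt (fun x : ℝ => (x, p.2)) p.1 := by fun_prop
  filter_upwards [hc.preimage_mem_nhds (hU.mem_nhds hp)] with x hx using hfg hx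

theorem pdv_congr (hU : IsOpen U) (hfg : Set.EqOn f g U) (hp : p ∈ U) : pdv f p = pdv g p := by
  refine Filter.EventuallyEq.deriv_eq ?_
  have hc : ContinuousAt (fun y : ℝ => (p.1, y)) p.2 := by fun_prop
  filter_upwards [hc.preimage_mem_nhds (hU.mem_nhds hp)] with y hy using hfg hy

theorem ContDiffOn.fderiv_apply_of_isOpen (hf : ContDiffOn ℝ ∞ f U) (hU : IsOpen U)
    (e : ℝ × ℝ) : ContDiffOn ℝ ∞ (fun q => fderiv ℝ f q e) U :=
  (hf.fderiv_of_isOpen hU (by simp)).clm_apply contDiffOn_const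

theorem ContDiffOn.pdv (hf : ContDiffOn ℝ ∞ f U) (hU : IsOpen U) : ContDiffOn ℝ ∞ (pdv f) U :=
  (hf.fderiv_apply_of_isOpen hU (0, 1)).congr fun _ hq =>
    (hf.differentiableAt_of_isOpen hU hq).pdv_eq

theorem pdu_pdv_comm (hU : IsOpen U) (hf : ContDiffOn ℝ ∞ f U) (hp : p ∈ U) :
    pdu (pdv f) p = pdv (pdu f) p := by
  have hfd := fun {q} (hq : q ∈ U) => hf.differentiableAt_of_isOpen hU hq
  have hd : DifferentiableAt ℝ (fderiv ℝ f) p :=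
    ((hf.fderiv_of_isOpen hU (m := ∞) (by simp)).contDiffAt (hU.mem_nhds hp)).differentiableAt
      (by simp)
  have hsymm : IsSymmSndFDerivAt ℝ f p :=
    ((contDiffOn_infty.1 hf 2).contDiffAt (hU.mem_nhds hp)).isSymmSndFDerivAt (by simp)
  have happly (e : ℝ × ℝ) : DifferentiableAt ℝ (fun q => fderiv ℝ f q e) p :=
    (hf.fderiv_apply_of_isOpen hU e).differentiableAt_of_isOpen hU hp
  rw [pdu_congr hU (fun q hq => (hfd hq).pdv_eq) hp, pdv_congr hU (fun q hq => (hfd hq).pdu_eq) hp,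
    (happly _).pdu_eq, (happly _).pdv_eq, fderiv_clm_apply hd (by fun_prop),
    fderiv_clm_apply hd (by fun_prop)]
  simpa using hsymm (1, 0) (0, 1)

end PartialDerivatives

section Schwarzschild

variable {M : ℝ} {U : Set (ℝ × ℝ)} {r f : ℝ × ℝ → ℝ} {p : ℝ × ℝ}

theorem Dfun_pos (hr0 : 0 < r p) (hr2M : 2 * M < r p) : 0 < Dfun M r p := by
  simpa [Dfun] using (div_lt_one hr0).2 hr2M

theorem contDiffOn_Pv (hU : IsOpen U) (hr : ContDiffOn ℝ ∞ r U) (hr0 : ∀ q ∈ U, 0 < r q)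
    (hr2M : ∀ q ∈ U, 2 * M < r q) (hf : ContDiffOn ℝ ∞ f U) : ContDiffOn ℝ ∞ (Pv M r f) U := by
  have hD : ContDiffOn ℝ ∞ (Dfun M r) U :=
    contDiffOn_const.sub (contDiffOn_const.div hr fun q hq => (hr0 q hq).ne')
  exact ((hr.pow 2).div hD fun q hq => (Dfun_pos (hr0 q hq) (hr2M q hq)).ne').mul (hf.pdv hU)

theorem contDiffOn_iterate_Pv (hU : IsOpen U) (hr : ContDiffOn ℝ ∞ r U) (hr0 : ∀ q ∈ U, 0 < r q)
    (hr2M : ∀ q ∈ U, 2 * M < r q) (hf : ContDiffOn ℝ ∞ f U) (N : ℕ) :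
    ContDiffOn ℝ ∞ ((Pv M r)^[N] f) U := by
  induction N with
  | zero => exact hf
  | succ N ih =>
    rw [Function.iterate_succ_apply']
    exact contDiffOn_Pv hU hr hr0 hr2M ih

theorem pdv_eq_mul_Pv (hr0 : 0 < r p) (hr2M : 2 * M < r p) :
    pdv f p = Dfun M r p / r p ^ 2 * Pv M r f p := by
  have hD := (Dfun_pos hr0 hr2M).ne'
  have := hr0.ne'
  simp only [Pv]
  field_simp

theorem hasDerivAt_weight_fst (hrd : DifferentiableAt ℝ r p) (hr0 : 0 < r p)
    (hru : pdu r p = -(1 - 2 * M / r p)) :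
    HasDerivAt (fun x => Dfun M r (x, p.2) / r (x, p.2) ^ 2)
      (Dfun M r p / r p ^ 2 * (2 / r p - 6 * M / r p ^ 2)) p.1 := by
  have h1 := hrd.hasDerivAt_pdu
  have h0 : r p ≠ 0 := hr0.ne'
  rw [hru] at h1
  refine ((((hasDerivAt_const p.1 (2 * M)).div h1 h0).const_sub 1).div (h1.pow 2)
    (pow_ne_zero 2 h0)).congr_deriv ?_
  simp only [Dfun, Prod.mk.eta, Pi.pow_apply, Pi.div_apply]
  field_simp
  ring

/-- The `u`-derivative of `(D/r²)^m ∂ᵥf`, written in terms of `((r²/D)∂ᵥ)f`. -/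
theorem pdu_weight_zpow_mul_pdv (hU : IsOpen U) (hr : ContDiffOn ℝ ∞ r U)
    (hr0 : ∀ q ∈ U, 0 < r q) (hr2M : ∀ q ∈ U, 2 * M < r q)
    (hru : ∀ q ∈ U, pdu r q = -(1 - 2 * M / r q)) (hf : ContDiffOn ℝ ∞ f U) (m : ℤ)
    (hp : p ∈ U) :
    pdu (fun q => (Dfun M r q / r q ^ 2) ^ m * pdv f q) p =
      (Dfun M r p / r p ^ 2) ^ (m + 1) *
        (pdu (Pv M r f) p + (m + 1) * (2 / r p - 6 * M / r p ^ 2) * Pv M r f p) := by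
  have hw : ∀ q ∈ U, Dfun M r q / r q ^ 2 ≠ 0 := fun q hq =>
    (div_pos (Dfun_pos (hr0 q hq) (hr2M q hq)) (pow_pos (hr0 q hq) 2)).ne'
  have heq : Set.EqOn (fun q => (Dfun M r q / r q ^ 2) ^ m * pdv f q)
      (fun q => (Dfun M r q / r q ^ 2) ^ (m + 1) * Pv M r f q) U := fun q hq => by
    simp only [pdv_eq_mul_Pv (f := f) (hr0 q hq) (hr2M q hq), zpow_add_one₀ (hw q hq), mul_assoc]
  rw [pdu_congr hU heq hp]
  have hwd := hasDerivAt_weight_fst (hr.differentiableAt_of_isOpen hU hp) (hr0 p hp) (hru p hp)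
  have hPd :=
    ((contDiffOn_Pv hU hr hr0 hr2M hf).differentiableAt_of_isOpen hU hp).hasDerivAt_pdu
  have hz := HasDerivAt.comp p.1
    (hasDerivAt_zpow (m + 1) (Dfun M r p / r p ^ 2) (Or.inl (hw p hp))) hwd
  refine (hz.mul hPd).deriv.trans ?_
  have hsub : m + 1 - 1 = m := by ring
  simp only [Function.comp_apply, Prod.mk.eta, hsub, zpow_add_one₀ (hw p hp)]
  push_cast
  ring

/-- The transport equation in the `u` direction for the iterates `((r²/D)∂ᵥ)^(N+1) α`. -/
theorem pdu_iterate_Pv_succ (hU : IsOpen U) (hr : ContDiffOn ℝ ∞ r U)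
    (hr0 : ∀ q ∈ U, 0 < r q) (hr2M : ∀ q ∈ U, 2 * M < r q)
    (hru : ∀ q ∈ U, pdu r q = -(1 - 2 * M / r q)) (hrv : ∀ q ∈ U, pdv r q = 1 - 2 * M / r q)
    {s ℓ : ℤ} {α : ℝ × ℝ → ℝ} (hα : ContDiffOn ℝ ∞ α U) (hTeuk : TeukSol M r U s ℓ α) (N : ℕ) :
    ∀ p ∈ U, pdu ((Pv M r)^[N + 1] α) p =
      -((N + s + 1) * (2 / r p - 6 * M / r p ^ 2) * (Pv M r)^[N + 1] α p) +
        (N * (N + 1 + 2 * s) + -(ℓ - s) * (ℓ + s + 1) -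
          ((1 + s) * (1 + 2 * s) + 3 * N * (N + 1 + 2 * s)) * (2 * M / r p)) *
          (Pv M r)^[N] α p +
        2 * M * (N * (N + s) * (N + 2 * s)) * (Pv M r)^[N - 1] α p := by
  have hw : ∀ q ∈ U, Dfun M r q / r q ^ 2 ≠ 0 := fun q hq =>
    (div_pos (Dfun_pos (hr0 q hq) (hr2M q hq)) (pow_pos (hr0 q hq) 2)).ne'
  induction N with
  | zero =>
    intro p hp
    have hrp : r p ≠ 0 := (hr0 p hp).ne'
    have hT := hTeuk p hp
    have heq : Set.EqOn (fun q => r q ^ (-(2 * s)) * Dfun M r q ^ s * pdv α q)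
        (fun q => (Dfun M r q / r q ^ 2) ^ s * pdv α q) U := fun q _ => by
      simp only [div_zpow, zpow_neg, zpow_mul, zpow_ofNat]
      ring
    have h2 : r p ^ (-2 - 2 * s) = ((r p ^ 2) ^ (s + 1))⁻¹ := by
      rw [← zpow_natCast, ← zpow_mul, ← zpow_neg]
      congr 1
      push_cast
      ring
    have h3 : r p ^ (-3 - 2 * s) = ((r p ^ 2) ^ (s + 1))⁻¹ * (r p)⁻¹ := by
      rw [← h2, ← zpow_sub_one₀ hrp]
      congr 1
      ring
    rw [pdu_congr hU heq hp, pdu_weight_zpow_mul_pdv hU hr hr0 hr2M hru hα s hp, h2, h3] at hT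
    have hT' := mul_left_cancel₀ (zpow_ne_zero (s + 1) (hw p hp)) (hT.trans
      (b := _) (c := (Dfun M r p / r p ^ 2) ^ (s + 1) *
        ((-(ℓ - s) * (ℓ + s + 1) - (1 + s) * (1 + 2 * s) * (2 * M / r p)) * α p)) (by
          rw [div_zpow]
          push_cast
          ring))
    simp only [zero_add, Function.iterate_one, Function.iterate_zero, id_eq, Nat.cast_zero]
    linear_combination hT'
  | succ N ih =>
    intro p hp
    have hrp : r p ≠ 0 := (hr0 p hp).ne'
    have hg := contDiffOn_iterate_Pv hU hr hr0 hr2M hα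
    have hgv (k : ℕ) : HasDerivAt (fun y => (Pv M r)^[k] α (p.1, y))
        (Dfun M r p / r p ^ 2 * (Pv M r)^[k + 1] α p) p.2 := by
      rw [Function.iterate_succ_apply', ← pdv_eq_mul_Pv (hr0 p hp) (hr2M p hp)]
      exact ((hg k).differentiableAt_of_isOpen hU hp).hasDerivAt_pdv
    have hlow : HasDerivAt
        (fun y => 2 * M * (N * (N + s) * (N + 2 * s)) * (Pv M r)^[N - 1] α (p.1, y))
        (2 * M * (N * (N + s) * (N + 2 * s)) * (Dfun M r p / r p ^ 2 * (Pv M r)^[N] α p)) p.2 := by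
      cases N with
      | zero => simpa using hasDerivAt_const p.2 (0 : ℝ)
      | succ k => exact (hgv k).const_mul _
    have hrd := (hr.differentiableAt_of_isOpen hU hp).hasDerivAt_pdv
    rw [hrv p hp] at hrd
    have hinv := hrd.inv hrp
    have hcomm := pdu_pdv_comm hU (hg (N + 1)) hp
    have hleft := pdu_weight_zpow_mul_pdv hU hr hr0 hr2M hru (hg (N + 1)) 0 hp
    simp only [zpow_zero, one_mul, zero_add, zpow_one, Int.cast_zero] at hleft
    rw [← Function.iterate_succ_apply' (Pv M r)] at hleft
    have hright := (((((((hinv.const_mul 2).sub ((hinv.pow 2).const_mul (6 * M))).const_mul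
      (N + s + 1 : ℝ)).mul (hgv (N + 1))).neg).add
      ((((hinv.const_mul (2 * M)).const_mul
        ((1 + s) * (1 + 2 * s) + 3 * N * (N + 1 + 2 * s) : ℝ)).const_sub
        (N * (N + 1 + 2 * s) + -(ℓ - s) * (ℓ + s + 1) : ℝ)).mul (hgv N))).add hlow).deriv
    have hright' : pdv (pdu ((Pv M r)^[N + 1] α)) p = _ :=
      (pdv_congr hU (fun q hq => ih q hq) hp).trans
        (Eq.trans (congrArg (fun F : ℝ → ℝ => deriv F p.2) (funext fun y => by
          simp [div_eq_mul_inv])) hright)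
    rw [← hcomm] at hright'
    have hkey := hleft.symm.trans hright'
    refine mul_left_cancel₀ (hw p hp) ?_
    have hDr : Dfun M r p = 1 - 2 * M / r p := rfl
    simp only [Pi.inv_apply, Pi.pow_apply, Pi.sub_apply, Prod.mk.eta,
      Nat.add_sub_cancel] at hkey ⊢
    push_cast
    rw [← hDr] at hkey
    linear_combination hkey

end Schwarzschild

/-- The `∂ᵥ`-commuted Teukolsky equation (Proposition 8.1, eq. (8.7)), in scalar
fixed-angular-mode form. -/
theorem commuted_teukolsky_equation_v
    (M : ℝ) (hM : 0 ≤ M)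
    (U : Set (ℝ × ℝ)) (hUopen : IsOpen U)
    (r : ℝ × ℝ → ℝ) (hr : ContDiffOn ℝ ∞ r U)
    (hr2M : ∀ p ∈ U, 2 * M < r p)
    (hru : ∀ p ∈ U, pdu r p = -(1 - 2 * M / r p))
    (hrv : ∀ p ∈ U, pdv r p = 1 - 2 * M / r p)
    (s ℓ : ℤ) (hsl : |s| ≤ ℓ)
    (α : ℝ × ℝ → ℝ) (hα : ContDiffOn ℝ ∞ α U)
    (hTeuk : TeukSol M r U s ℓ α) :
    ∀ N : ℕ, 1 ≤ N → ∀ p ∈ U,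
      pdu (fun q => (Dfun M r q / (r q) ^ 2) ^ ((N : ℤ) + s) * pdv ((Pv M r)^[N] α) q) p =
        (Dfun M r p / (r p) ^ 2) ^ ((N : ℤ) + s + 1) *
          ((((((N : ℤ) * ((N : ℤ) + 1 + 2 * s) : ℤ) : ℝ) + ((-(ℓ - s) * (ℓ + s + 1) : ℤ) : ℝ)
                - (((1 + s) * (1 + 2 * s) + 3 * (N : ℤ) * ((N : ℤ) + 1 + 2 * s) : ℤ) : ℝ) *
                  (2 * M / r p)) *
              ((Pv M r)^[N] α) p) +
            2 * M * (((N : ℤ) * ((N : ℤ) + s) * ((N : ℤ) + 2 * s) : ℤ) : ℝ) *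
              ((Pv M r)^[N - 1] α) p) := by
  intro N _ p hp
  have hr0 : ∀ q ∈ U, 0 < r q := fun q hq => by linarith [hr2M q hq]
  have hg := contDiffOn_iterate_Pv hUopen hr hr0 hr2M hα N
  rw [pdu_weight_zpow_mul_pdv hUopen hr hr0 hr2M hru hg _ hp,
    ← Function.iterate_succ_apply' (Pv M r),
    pdu_iterate_Pv_succ hUopen hr hr0 hr2M hru hrv hα hTeuk N p hp]
  push_cast
  ring
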